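/- Set R=N/4. The zeroth Fourier coefficient of f ↦ ˜Λ_R(f+1)˜H_R(f) equals β(0) = ∏_{r prime, deg r < R} (1 + 3/(2^{2·deg r} + 2·2^{deg r} − 3)); in particular β(0) ≥ 1. -/

import Mathlib

open Polynomial
open scoped Classical

noncomputable section

abbrev F2 := ZMod 2
abbrev Kinf := LaurentSeries F2
def polyToK (f : F2[X]) : Kinf :=
  ∑ i ∈ f.support, HahnSeries.single (-(i : ℤ)) (f.coeff i)
def ordK (a : Kinf) : WithBot ℤ := if a = 0 then ⊥ else (↑(-a.order) : WithBot ℤ)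
def eKr (a : Kinf) : ℝ := (-1 : ℝ) ^ ((a.coeff 1).val)
def eK (a : Kinf) : ℂ := ((eKr a : ℝ) : ℂ)
def InT (θ : Kinf) : Prop := ordK θ ≤ ((-1 : ℤ) : WithBot ℤ)
def GN (N : ℕ) : Finset F2[X] :=
  Set.Finite.toFinset (s := {f : F2[X] | f.degree < (N : ℕ)}) (by
    have h : {f : F2[X] | f.degree < (N : ℕ)} = ↑(Polynomial.degreeLT F2 N) := by
      ext f
      simp [Polynomial.mem_degreeLT]
    rw [h]
    have : Finite (Polynomial.degreeLT F2 N) :=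
      Finite.of_equiv _ (Polynomial.degreeLTEquiv F2 N).symm.toEquiv
    exact (Polynomial.degreeLT F2 N : Set F2[X]).toFinite)
def ratK (u s : F2[X]) : Kinf := polyToK u * (polyToK s)⁻¹

/-- τ(f): the number of divisors of `f`. -/
def tau (f : F2[X]) : ℕ := ((GN (f.natDegree + 1)).filter (fun g => g ∣ f)).card

/-- φ(f): the number of invertible residues modulo `f`. -/
def phi (f : F2[X]) : ℕ := ((GN f.natDegree).filter (fun g => IsCoprime g f)).card

/-- ω(f): the number of (irreducible nonconstant, i.e. prime) divisors of `f`. -/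
def omegaP (f : F2[X]) : ℕ :=
  ((GN (f.natDegree + 1)).filter (fun r => Irreducible r ∧ r ∣ f)).card

/-- The Möbius function on `F₂[x]`. -/
def mu (f : F2[X]) : ℤ := if Squarefree f then (-1) ^ (omegaP f) else 0

/-- The set of invertible residues modulo `s` (canonical representatives of
`(F₂[x]/(s))^×`, i.e. polynomials of degree `< deg s` coprime to `s`). -/
def residues (s : F2[X]) : Finset F2[X] := (GN s.natDegree).filter (fun t => IsCoprime t s)

/-- `α(s) = μ(s)/φ(s)`. -/
def alphaA (s : F2[X]) : ℝ := (mu s : ℝ) / (phi s : ℝ)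

/-- `α'(s) = ∏_{r | s prime} 3/(2^{deg r}+3)` for `s` squarefree, `0` otherwise. -/
def alphaB (s : F2[X]) : ℝ :=
  if Squarefree s then
    ∏ r ∈ (GN (s.natDegree + 1)).filter (fun r => Irreducible r ∧ r ∣ s),
      (3 : ℝ) / ((2 : ℝ) ^ r.natDegree + 3)
  else 0

/-- `Λ_M(f) = Σ_{s ∈ G_M} α(s) Σ_{t ∈ (F₂[x]/(s))^×} e(f t s⁻¹)`. -/
def LambdaM (M : ℕ) (f : F2[X]) : ℝ :=
  ∑ s ∈ GN M, alphaA s * ∑ t ∈ residues s, eKr (polyToK f * ratK t s)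

/-- `H_M(f) = Σ_{s ∈ G_M} α'(s) Σ_{t ∈ (F₂[x]/(s))^×} e(f t s⁻¹)`. -/
def HM (M : ℕ) (f : F2[X]) : ℝ :=
  ∑ s ∈ GN M, alphaB s * ∑ t ∈ residues s, eKr (polyToK f * ratK t s)

/-- `Λ'(f) = deg f` if `f` is prime, `0` otherwise. -/
def LambdaP (f : F2[X]) : ℝ := if Irreducible f then (f.natDegree : ℝ) else 0

/-- `Ψ(f) = Λ'(f+1) H_Q(f) 1_{f ∈ G_N}`. -/
def Psi (N Q : ℕ) (f : F2[X]) : ℝ :=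
  LambdaP (f + 1) * HM Q f * (if f ∈ GN N then 1 else 0)

/-- `Ψ'(f) = Λ_R(f+1) H_Q(f) 1_{f ∈ G_N}`. -/
def Psi' (N R Q : ℕ) (f : F2[X]) : ℝ :=
  LambdaM R (f + 1) * HM Q f * (if f ∈ GN N then 1 else 0)

/-- `Λ_r(f)` for a single prime `r`. -/
def Lambda_r (r f : F2[X]) : ℝ :=
  if r ∣ f then 0 else (2 : ℝ) ^ r.natDegree / ((2 : ℝ) ^ r.natDegree - 1)

/-- `τ²_r(f)` for a single prime `r`. -/
def tauSq_r (r f : F2[X]) : ℝ :=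
  if r ∣ f then 4 * (2 : ℝ) ^ r.natDegree / ((2 : ℝ) ^ r.natDegree + 3)
  else (2 : ℝ) ^ r.natDegree / ((2 : ℝ) ^ r.natDegree + 3)

/-- `˜Λ_M(f) = ∏_{r ∈ G_M prime} Λ_r(f)`. -/
def LambdaTilde (M : ℕ) (f : F2[X]) : ℝ :=
  ∏ r ∈ (GN M).filter (fun r => Irreducible r), Lambda_r r f

/-- `˜H_M(f) = ∏_{r ∈ G_M prime} τ²_r(f)`. -/
def HTilde (M : ℕ) (f : F2[X]) : ℝ :=
  ∏ r ∈ (GN M).filter (fun r => Irreducible r), tauSq_r r f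

/-- The element of `K∞` determined by a rational function (with `x ↦ t⁻¹`). -/
def ratToK (l : RatFunc F2) : Kinf := polyToK l.num * (polyToK l.denom)⁻¹

/-- `c : F₂(x)/F₂[x] → ℝ` (encoded on the canonical representatives
`λ = num/denom` in lowest terms with `deg num < deg denom`) is the system of Fourier
coefficients of `F : F₂[x] → ℝ`, i.e. `F(f) = Σ_λ c(λ) e(λ f)`. -/
def IsFourierCoeffs (F : F2[X] → ℝ) (c : RatFunc F2 → ℝ) : Prop :=
  (Function.support c).Finite ∧
  (∀ l : RatFunc F2, c l ≠ 0 → (l.num).degree < (l.denom).degree) ∧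
  ∀ f : F2[X], F f = ∑ᶠ l : RatFunc F2, c l * eKr (ratToK l * polyToK f)

/-- The canonical representative (mod `F₂[x]`) of a rational function. -/
def fracRat (l : RatFunc F2) : RatFunc F2 :=
  l - algebraMap F2[X] (RatFunc F2) (l.num / l.denom)

/-- `c(n, η)` from the statement of the exponential sum estimate for `Λ'`. -/
def cFun (n : ℕ) (η : Kinf) : ℝ :=
  if ordK η < ((-(n : ℤ) - 1 : ℤ) : WithBot ℤ) then 1
  else if ordK η = ((-(n : ℤ) - 1 : ℤ) : WithBot ℤ) then -1
  else 0

/-- The class `C_B(X)` (with explicit implied constant `Cst`): functions whose Fourier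
coefficients are supported on `λ` with squarefree denominator of degree `≤ X` and satisfy
`|c(λ)| ≤ Cst · τ(denom λ)^B / 2^{deg (denom λ)}`. -/
def InClassC (B X : ℕ) (Cst : ℝ) (F : F2[X] → ℝ) : Prop :=
  ∃ c : RatFunc F2 → ℝ, IsFourierCoeffs F c ∧
    (∀ l : RatFunc F2, c l ≠ 0 → Squarefree l.denom ∧ (l.denom).natDegree ≤ X) ∧
    (∀ l : RatFunc F2, |c l| ≤ Cst * (tau l.denom : ℝ) ^ B / 2 ^ (l.denom).natDegree)

/-- The fractional part `‖θ‖` of `θ ∈ K∞`: keep exactly the coefficients of `x^{-n}`, `n ≥ 1`. -/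
def fracK (θ : Kinf) : Kinf :=
  ⟨fun n => if 1 ≤ n then θ.coeff n else 0, by
    apply θ.isPWO_support'.mono
    intro n hn
    simp only [Function.mem_support, ne_eq] at hn ⊢
    intro h
    apply hn
    split_ifs
    · exact h
    · rfl⟩


namespace S17

lemma sum_comp_surj {A B : Type*} [AddGroup A] [AddGroup B] [Fintype A] [Fintype B]
    (φ : A →+ B) (hφ : Function.Surjective φ) (G : B → ℝ) :
    (∑ a, G (φ a)) * (Fintype.card B : ℝ) = (Fintype.card A : ℝ) * ∑ b, G b := by
  set c : ℕ := (Finset.univ.filter (fun a => φ a = 0)).card with hc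
  have hfib : ∀ b : B, (Finset.univ.filter (fun a => φ a = b)).card = c := fun b =>
    AddMonoidHom.card_fiber_eq_of_mem_range φ (hφ b) (hφ 0)
  have key : ∀ H : B → ℝ, ∑ a, H (φ a) = c * ∑ b, H b := by
    intro H
    rw [← Finset.sum_fiberwise Finset.univ (fun a => φ a) (fun a => H (φ a)), Finset.mul_sum]
    refine Finset.sum_congr rfl fun b _ => ?_
    rw [Finset.sum_congr rfl (g := fun _ => H b)]
    · rw [Finset.sum_const, hfib b, nsmul_eq_mul]
    · intro a ha
      rw [(Finset.mem_filter.1 ha).2]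
  have h1 := key (fun _ => 1)
  simp at h1
  rw [key G, h1]
  ring

lemma coeff_polyToK (f : F2[X]) (n : ℤ) :
    (polyToK f).coeff n = if n ≤ 0 then f.coeff n.natAbs else 0 := by
  unfold polyToK
  rw [HahnSeries.coeff_sum]
  simp only [HahnSeries.coeff_single]
  split_ifs with hn
  · by_cases h : f.coeff n.natAbs = 0
    · rw [h]
      refine Finset.sum_eq_zero fun i _ => ?_
      split_ifs with h2
      · have : i = n.natAbs := by omega
        rw [this, h]
      · rfl
    · rw [Finset.sum_eq_single n.natAbs]
      · rw [if_pos (by omega)]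
      · intro b _ hb
        rw [if_neg (by omega)]
      · intro h2
        simp at h2
        exact absurd h2 h
  · refine Finset.sum_eq_zero fun i _ => ?_
    rw [if_neg (by omega)]

lemma polyToK_add (f g : F2[X]) : polyToK (f + g) = polyToK f + polyToK g := by
  ext n
  rw [HahnSeries.coeff_add, coeff_polyToK, coeff_polyToK, coeff_polyToK]
  split_ifs <;> simp

lemma polyToK_ne_zero {f : F2[X]} (hf : f ≠ 0) : polyToK f ≠ 0 := by
  intro h
  have := coeff_polyToK f (-(f.natDegree : ℤ))
  rw [h, if_pos (by omega)] at this
  simp at this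
  exact hf (leadingCoeff_eq_zero.1 this.symm)

lemma order_polyToK {f : F2[X]} (hf : f ≠ 0) : (polyToK f).order = -(f.natDegree : ℤ) := by
  apply le_antisymm
  · apply HahnSeries.order_le_of_coeff_ne_zero
    rw [coeff_polyToK, if_pos (by omega)]
    simpa using hf
  · by_contra! hlt
    have h0 := (HahnSeries.coeff_order_eq_zero (x := polyToK f)).not.2 (polyToK_ne_zero hf)
    apply h0
    rw [coeff_polyToK]
    split_ifs
    · apply coeff_eq_zero_of_natDegree_lt
      omega
    · rfl

lemma polyToK_X_pow (j : ℕ) : polyToK (X ^ j) = HahnSeries.single (-(j : ℤ)) 1 := by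
  ext n
  rw [coeff_polyToK, HahnSeries.coeff_single, coeff_X_pow]
  split_ifs <;> first | rfl | omega

lemma eKr_add (a b : Kinf) : eKr (a + b) = eKr a * eKr b := by
  unfold eKr
  rw [HahnSeries.coeff_add]
  generalize a.coeff 1 = u
  generalize b.coeff 1 = v
  revert u v
  have h : ∀ u v : ZMod 2, (u + v).val % 2 = (u.val + v.val) % 2 := by decide
  intro u v
  rw [← pow_add, neg_one_pow_eq_pow_mod_two, h, ← neg_one_pow_eq_pow_mod_two]

lemma exists_neg (l : RatFunc F2) (hl : l ≠ 0) (hd : l.num.degree < l.denom.degree) :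
    ∃ j : ℕ, j < l.denom.natDegree ∧ eKr (ratToK l * polyToK (X ^ j)) = -1 := by
  have hn : l.num ≠ 0 := RatFunc.num_ne_zero hl
  have hdn : l.denom ≠ 0 := l.denom_ne_zero
  have hlt := natDegree_lt_natDegree hn hd
  have e1 : ratToK l * polyToK l.denom = polyToK l.num := by
    unfold ratToK
    rw [mul_assoc, inv_mul_cancel₀ (polyToK_ne_zero hdn), mul_one]
  have hr : ratToK l ≠ 0 := by
    intro h
    rw [h, zero_mul] at e1
    exact polyToK_ne_zero hn e1.symm
  have e2 := HahnSeries.order_mul hr (polyToK_ne_zero hdn)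
  rw [e1, order_polyToK hn, order_polyToK hdn] at e2
  refine ⟨l.denom.natDegree - l.num.natDegree - 1, by omega, ?_⟩
  have hc := (HahnSeries.coeff_order_eq_zero (x := ratToK l)).not.2 hr
  have e3 : (ratToK l).order =
      1 + ((l.denom.natDegree - l.num.natDegree - 1 : ℕ) : ℤ) := by omega
  set j := l.denom.natDegree - l.num.natDegree - 1
  have e4 : (ratToK l * polyToK (X ^ j)).coeff 1 = (ratToK l).coeff (ratToK l).order := by
    rw [polyToK_X_pow, e3]
    have := HahnSeries.coeff_mul_single_add (r := (1 : F2)) (x := ratToK l)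
      (a := 1 + (j : ℤ)) (b := -(j : ℤ))
    simpa using this
  unfold eKr
  rw [e4]
  revert hc
  generalize (ratToK l).coeff (ratToK l).order = u
  intro hc
  have : ∀ u : ZMod 2, u ≠ 0 → u.val = 1 := by decide
  rw [this u hc, pow_one]

lemma ratToK_zero : ratToK 0 = 0 := by
  unfold ratToK
  simp [polyToK]

instance (M : ℕ) : Fintype (degreeLT F2 M) :=
  Fintype.ofEquiv _ (Polynomial.degreeLTEquiv F2 M).symm.toEquiv

lemma sum_char (M : ℕ) (l : RatFunc F2) (hl : l ≠ 0) (hd : l.num.degree < l.denom.degree)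
    (hM : l.denom.natDegree ≤ M) :
    ∑ f : degreeLT F2 M, eKr (ratToK l * polyToK f.1) = 0 := by
  obtain ⟨j, hj, he⟩ := exists_neg l hl hd
  have hm : (X ^ j : F2[X]) ∈ degreeLT F2 M := by
    rw [mem_degreeLT, degree_X_pow]
    exact_mod_cast hj.trans_le hM
  have h := Equiv.sum_comp (Equiv.addRight (⟨X ^ j, hm⟩ : degreeLT F2 M))
    (fun f => eKr (ratToK l * polyToK f.1))
  have h2 : ∀ f : degreeLT F2 M,
      eKr (ratToK l * polyToK (Equiv.addRight (⟨X ^ j, hm⟩ : degreeLT F2 M) f).1)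
        = - eKr (ratToK l * polyToK f.1) := by
    intro f
    simp only [Equiv.coe_addRight, Submodule.coe_add]
    rw [polyToK_add, mul_add, eKr_add, he]
    ring
  simp only [h2, Finset.sum_neg_distrib] at h
  linarith

lemma monic_F2 {r : F2[X]} (hr : r ≠ 0) : r.Monic := by
  have : ∀ u : ZMod 2, u ≠ 0 → u = 1 := by decide
  exact this _ (leadingCoeff_ne_zero.2 hr)

/-- Local model function on the residue ring. -/
def h (r : F2[X]) (y : F2[X] ⧸ Ideal.span {r}) : ℝ :=
  (if y + 1 = 0 then 0 else (2 : ℝ) ^ r.natDegree / ((2 : ℝ) ^ r.natDegree - 1)) *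
  (if y = 0 then 4 * (2 : ℝ) ^ r.natDegree / ((2 : ℝ) ^ r.natDegree + 3)
  else (2 : ℝ) ^ r.natDegree / ((2 : ℝ) ^ r.natDegree + 3))

lemma h_mk (r f : F2[X]) :
    h r (Ideal.Quotient.mk _ f) = Lambda_r r (f + 1) * tauSq_r r f := by
  unfold h Lambda_r tauSq_r
  rw [← map_one (Ideal.Quotient.mk (Ideal.span {r})), ← map_add]
  simp only [Ideal.Quotient.eq_zero_iff_mem, Ideal.mem_span_singleton]

lemma fin_quot {r : F2[X]} (hr : r ≠ 0) : Finite (F2[X] ⧸ Ideal.span {r}) := by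
  have := (monic_F2 hr).finite_adjoinRoot
  exact Module.finite_of_finite F2 (M := AdjoinRoot r)

lemma card_quot {r : F2[X]} (hr : r ≠ 0) [Fintype (F2[X] ⧸ Ideal.span {r})] :
    Fintype.card (F2[X] ⧸ Ideal.span {r}) = 2 ^ r.natDegree := by
  have := (monic_F2 hr).finite_adjoinRoot
  have := Module.natCard_eq_pow_finrank (K := F2) (V := AdjoinRoot r)
  rw [(AdjoinRoot.powerBasis hr).finrank, AdjoinRoot.powerBasis_dim, Nat.card_zmod] at this
  rw [← this, ← Nat.card_eq_fintype_card]
  rfl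

lemma local_sum {r : F2[X]} (hr : Irreducible r) [Fintype (F2[X] ⧸ Ideal.span {r})] :
    ∑ y, h r y = (Fintype.card (F2[X] ⧸ Ideal.span {r}) : ℝ) *
      (1 + 3 / ((2 : ℝ) ^ (2 * r.natDegree) + 2 * (2 : ℝ) ^ r.natDegree - 3)) := by
  have hcard := card_quot hr.ne_zero
  have hdeg : 0 < r.natDegree := hr.natDegree_pos
  set q : ℝ := (2 : ℝ) ^ r.natDegree with hq
  have hq2 : 2 ≤ q := by
    calc (2 : ℝ) = 2 ^ 1 := by norm_num
      _ ≤ q := pow_le_pow_right₀ (by norm_num) hdeg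
  have hcr : (Fintype.card (F2[X] ⧸ Ideal.span {r}) : ℝ) = q := by
    rw [hcard]; push_cast; rfl
  have : Nontrivial (F2[X] ⧸ Ideal.span {r}) := by
    rw [← Fintype.one_lt_card_iff_nontrivial, hcard]
    exact Nat.one_lt_two_pow hdeg.ne'
  set A : ℝ := q ^ 2 / ((q - 1) * (q + 3)) with hA
  have hqm : q - 1 ≠ 0 := by linarith
  have hqp : q + 3 ≠ 0 := by linarith
  have hh : ∀ y, h r y = A + (if y = 0 then 3 * A else 0) + (if y = -1 then -A else 0) := by
    intro y
    unfold h
    rw [← hq, hA]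
    have e : y + 1 = 0 ↔ y = -1 := eq_neg_iff_add_eq_zero.symm
    simp only [e]
    by_cases h0 : y = 0
    · have : y ≠ -1 := by
        rw [h0]
        intro h1
        exact one_ne_zero (neg_eq_zero.1 h1.symm)
      rw [if_neg this, if_neg this, if_pos h0, if_pos h0]
      field_simp
      ring
    · rw [if_neg h0, if_neg h0]
      split_ifs
      · ring
      · field_simp
        ring
  simp only [hh, Finset.sum_add_distrib, Finset.sum_ite_eq', Finset.sum_const, Finset.mem_univ,
    if_true, Finset.card_univ, nsmul_eq_mul]
  rw [hcr, pow_mul', ← hq, hA]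
  have e : q ^ 2 + 2 * q - 3 = (q - 1) * (q + 3) := by ring
  rw [e]
  field_simp
  ring

lemma mean_F (S : Finset F2[X]) (hS : ∀ r ∈ S, Irreducible r) (M : ℕ)
    (hM : (∏ r ∈ S, r).natDegree ≤ M) :
    ∑ f : degreeLT F2 M, ∏ r ∈ S, (Lambda_r r (f.1 + 1) * tauSq_r r f.1) =
      (Fintype.card (degreeLT F2 M) : ℝ) * ∏ r ∈ S,
        (1 + 3 / ((2 : ℝ) ^ (2 * r.natDegree) + 2 * (2 : ℝ) ^ r.natDegree - 3)) := by
  let I : S → Ideal F2[X] := fun r => Ideal.span {r.1}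
  have hfin : ∀ r : S, Finite (F2[X] ⧸ I r) := fun r => fin_quot (hS r.1 r.2).ne_zero
  let _ : ∀ r : S, Fintype (F2[X] ⧸ I r) := fun r => Fintype.ofFinite _
  have hcop : Pairwise (Function.onFun IsCoprime I) := by
    intro a b hab
    change IsCoprime (Ideal.span {a.1}) (Ideal.span {b.1})
    rw [Ideal.isCoprime_span_singleton_iff]
    rw [(hS a.1 a.2).coprime_iff_not_dvd]
    intro hdvd
    have := (hS a.1 a.2).associated_of_dvd (hS b.1 b.2) hdvd
    have := eq_of_monic_of_associated (monic_F2 (hS a.1 a.2).ne_zero)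
      (monic_F2 (hS b.1 b.2).ne_zero) this
    exact hab (Subtype.ext this)
  let φ : degreeLT F2 M →+ (∀ r : S, F2[X] ⧸ I r) :=
    (RingHom.pi (fun r => Ideal.Quotient.mk (I r))).toAddMonoidHom.comp
      (degreeLT F2 M).subtype.toAddMonoidHom
  have hφa : ∀ f r, φ f r = Ideal.Quotient.mk (I r) f.1 := fun f r => rfl
  have hP0 : (∏ r ∈ S, r) ≠ 0 := Finset.prod_ne_zero_iff.2 fun r hr => (hS r hr).ne_zero
  have hPm := monic_F2 hP0
  have hφ : Function.Surjective φ := by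
    intro y
    obtain ⟨g, hg⟩ := Ideal.pi_quotient_surjective hcop y
    refine ⟨⟨g %ₘ (∏ r ∈ S, r), ?_⟩, ?_⟩
    · rw [mem_degreeLT]
      refine (degree_modByMonic_lt g hPm).trans_le ?_
      rw [degree_eq_natDegree hP0]
      exact_mod_cast hM
    · funext r
      rw [hφa, ← hg r]
      change Ideal.Quotient.mk (I r) (g %ₘ (∏ r ∈ S, r)) = Ideal.Quotient.mk (I r) g
      rw [Ideal.Quotient.eq, Ideal.mem_span_singleton]
      have e := modByMonic_add_div g (∏ r ∈ S, r)
      have e2 : g %ₘ (∏ r ∈ S, r) - g = (∏ r ∈ S, r) * (-(g /ₘ (∏ r ∈ S, r))) := by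
        linear_combination e
      rw [e2]
      exact (Finset.dvd_prod_of_mem _ r.2).mul_right _
  have key := sum_comp_surj φ hφ (fun y => ∏ r : S, h r.1 (y r))
  have hsum : ∑ y : (∀ r : S, F2[X] ⧸ I r), ∏ r : S, h r.1 (y r) = ∏ r : S, ∑ z, h r.1 z :=
    (Fintype.prod_sum (fun (r : S) (z : F2[X] ⧸ I r) => h r.1 z)).symm
  rw [hsum] at key
  have hloc : ∀ r : S, ∑ z, h r.1 z = (Fintype.card (F2[X] ⧸ I r) : ℝ) *
      (1 + 3 / ((2 : ℝ) ^ (2 * r.1.natDegree) + 2 * (2 : ℝ) ^ r.1.natDegree - 3)) :=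
    fun r => local_sum (hS r.1 r.2)
  simp only [hloc, Finset.prod_mul_distrib, Fintype.card_pi, Nat.cast_prod] at key
  have hc0 : (∏ r : S, (Fintype.card (F2[X] ⧸ I r) : ℝ)) ≠ 0 := by
    refine Finset.prod_ne_zero_iff.2 fun r _ => ?_
    exact_mod_cast Fintype.card_ne_zero
  have hL : ∀ f : degreeLT F2 M, ∏ r : S, h r.1 (φ f r) =
      ∏ r ∈ S, (Lambda_r r (f.1 + 1) * tauSq_r r f.1) := by
    intro f
    rw [← Finset.prod_coe_sort S]
    exact Finset.prod_congr rfl fun r _ => h_mk r.1 f.1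
  simp only [hL] at key
  rw [Finset.prod_coe_sort S (fun r : F2[X] =>
    (1 + 3 / ((2 : ℝ) ^ (2 * r.natDegree) + 2 * (2 : ℝ) ^ r.natDegree - 3)))] at key
  apply mul_right_cancel₀ hc0
  rw [key]
  ring

end S17

/-- With `R = N/4`: the zeroth Fourier coefficient of `f ↦ ˜Λ_R(f+1)˜H_R(f)` equals
`∏_{r prime, deg r < R} (1 + 3/(2^{2 deg r} + 2·2^{deg r} − 3))`; in particular `β(0) ≥ 1`. -/
theorem statement_17 (N : ℕ) (β : RatFunc F2 → ℝ)
    (hβ : IsFourierCoeffs (fun f => LambdaTilde (N / 4) (f + 1) * HTilde (N / 4) f) β) :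
    β 0 = ∏ r ∈ (GN (N / 4)).filter (fun r => Irreducible r),
        (1 + 3 / ((2 : ℝ) ^ (2 * r.natDegree) + 2 * (2 : ℝ) ^ r.natDegree - 3)) ∧
      1 ≤ β 0 := by
  obtain ⟨hfin, hdeg, hF⟩ := hβ
  set S := (GN (N / 4)).filter (fun r => Irreducible r) with hSdef
  have hS : ∀ r ∈ S, Irreducible r := fun r hr => (Finset.mem_filter.1 hr).2
  set T : Finset (RatFunc F2) := insert 0 hfin.toFinset with hT
  set M : ℕ := (∏ r ∈ S, r).natDegree + ∑ l ∈ T, l.denom.natDegree with hM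
  have hmean := S17.mean_F S hS M (by omega)
  have hFT : ∀ f : F2[X], ∏ r ∈ S, (Lambda_r r (f + 1) * tauSq_r r f) =
      ∑ l ∈ T, β l * eKr (ratToK l * polyToK f) := by
    intro f
    rw [Finset.prod_mul_distrib]
    refine (hF f).trans (finsum_eq_sum_of_support_subset _ ?_)
    intro l hl
    have : β l ≠ 0 := left_ne_zero_of_mul hl
    simp [hT, this]
  simp only [hFT] at hmean
  rw [Finset.sum_comm, Finset.sum_eq_single (0 : RatFunc F2)] at hmean
  · have hz : ∀ f : F2[X], eKr (ratToK 0 * polyToK f) = 1 := by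
      intro f
      rw [S17.ratToK_zero, zero_mul]
      simp [eKr]
    simp only [hz, mul_one, Finset.sum_const, Finset.card_univ, nsmul_eq_mul] at hmean
    have hc : (Fintype.card (degreeLT F2 M) : ℝ) ≠ 0 := by
      exact_mod_cast Fintype.card_ne_zero
    have hb := mul_left_cancel₀ hc hmean
    refine ⟨hb, ?_⟩
    rw [hb]
    refine (Finset.prod_const_one (s := S)).symm.le.trans ?_
    refine Finset.prod_le_prod (fun _ _ => zero_le_one) fun r hr => ?_
    have hq : (2 : ℝ) ≤ 2 ^ r.natDegree := by
      calc (2 : ℝ) = 2 ^ 1 := by norm_num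
        _ ≤ _ := pow_le_pow_right₀ (by norm_num) (hS r hr).natDegree_pos
    have : 0 ≤ 3 / ((2 : ℝ) ^ (2 * r.natDegree) + 2 * (2 : ℝ) ^ r.natDegree - 3) := by
      apply div_nonneg (by norm_num)
      have : (0 : ℝ) ≤ 2 ^ (2 * r.natDegree) := by positivity
      linarith
    linarith
  · intro l hl hl0
    rw [← Finset.mul_sum]
    by_cases hb : β l = 0
    · rw [hb, zero_mul]
    · rw [S17.sum_char M l hl0 (hdeg l hb), mul_zero]
      have := Finset.single_le_sum (f := fun l : RatFunc F2 => l.denom.natDegree)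
        (fun _ _ => Nat.zero_le _) hl
      omega
  · intro h0
    exact absurd (Finset.mem_insert_self _ _) h0
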